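/- Fix integers ν ≥ 1, m ≥ 1, set M = 2^m, r = 2^{ν+7}, and s = max{2ν + 9, 11 + ν + m}. For each j = 1, …, M−1 let Ŵ_{r,j} be the fixed-precision repeated-squaring approximation (with s-bit truncations) of W_j^r, where W_j = 1 − (x_j/r)² + i·(x_j/r) and x_j = jπ/(2M), and let ℓ_j be the truncation of 4M²·(Im(Ŵ_{r,j}))² to ν binary digits after the binary point, i.e. 0 ≤ 4M²·(Im(Ŵ_{r,j}))² − ℓ_j ≤ 2^{−ν}. Then |4M²·sin²(jπ/(2M)) − ℓ_j| ≤ 17·2^{−ν}·M² for every j = 1, …, M−1. -/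

import Mathlib

open Real

theorem norm_repeated_squaring_sub_exp_le {w : ℕ → ℂ} {n : ℕ} {z : ℂ} {D η : ℝ}
    (hz : ∀ i : ℕ, ‖Complex.exp (2 ^ i * z)‖ = 1)
    (h0 : ‖w 0 - Complex.exp z‖ ≤ D)
    (hw : ∀ i ≤ n, ‖w i‖ ≤ 1)
    (hstep : ∀ i < n, ‖w (i + 1) - w i ^ 2‖ ≤ η) :
    ∀ i ≤ n, ‖w i - Complex.exp (2 ^ i * z)‖ + η ≤ 2 ^ i * (D + η) := by
  intro i
  induction i with
  | zero => intro _; simpa using h0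
  | succ i ih =>
    intro hi
    have hprev := ih (by omega)
    have hexp : Complex.exp (2 ^ (i + 1) * z) = Complex.exp (2 ^ i * z) ^ 2 := by
      rw [← Complex.exp_nat_mul]
      congr 1
      push_cast
      ring
    have hsq : ‖w i ^ 2 - Complex.exp (2 ^ i * z) ^ 2‖
        ≤ 2 * ‖w i - Complex.exp (2 ^ i * z)‖ := by
      rw [sq_sub_sq, norm_mul]
      gcongr
      linarith [norm_add_le (w i) (Complex.exp (2 ^ i * z)), hw i (by omega), hz i]
    have htri := norm_sub_le_norm_sub_add_norm_sub (w (i + 1)) (w i ^ 2)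
      (Complex.exp (2 ^ i * z) ^ 2)
    rw [hexp, pow_succ (2 : ℝ) i]
    linarith [hstep i (by omega)]

theorem norm_one_sub_sq_add_mul_I_le_one {y : ℝ} (hy : |y| ≤ 1) :
    ‖1 - (y : ℂ) ^ 2 + (y : ℝ) * Complex.I‖ ≤ 1 := by
  have hy2 : y ^ 2 ≤ 1 := (sq_le_one_iff_abs_le_one y).2 hy
  have hform : 1 - (y : ℂ) ^ 2 + (y : ℝ) * Complex.I
      = ((1 - y ^ 2 : ℝ) : ℂ) + (y : ℝ) * Complex.I := by
    push_cast
    ring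
  rw [hform, Complex.norm_add_mul_I]
  refine Real.sqrt_le_one.2 ?_
  nlinarith [sq_nonneg y]

theorem norm_one_sub_sq_add_mul_I_sub_exp_le {x y : ℝ} (hx : |x| ≤ 1) :
    ‖1 - (y : ℂ) ^ 2 + (y : ℝ) * Complex.I - Complex.exp (x * Complex.I)‖
      ≤ x ^ 2 + y ^ 2 + |x - y| := by
  have hexp := Complex.norm_exp_sub_one_sub_id_le (x := x * Complex.I) (by simpa using hx)
  have hform : 1 - (y : ℂ) ^ 2 + (y : ℝ) * Complex.I - Complex.exp (x * Complex.I)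
      = -(Complex.exp (x * Complex.I) - 1 - x * Complex.I) - (y : ℂ) ^ 2
        - ((x - y : ℝ) : ℂ) * Complex.I := by
    push_cast
    ring
  rw [hform]
  refine (norm_sub_le _ _).trans (add_le_add ((norm_sub_le _ _).trans (add_le_add ?_ ?_)) ?_)
  · rw [norm_neg]
    simpa using hexp
  · simp
  · rw [norm_mul, Complex.norm_I, mul_one, Complex.norm_real, Real.norm_eq_abs]

theorem norm_le_two_mul_of_abs_re_le_of_abs_im_le {z : ℂ} {ε : ℝ}
    (hre : |z.re| ≤ ε) (him : |z.im| ≤ ε) : ‖z‖ ≤ 2 * ε := by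
  linarith [Complex.norm_le_abs_re_add_abs_im z]

theorem abs_sin_sq_sub_im_sq_le {w : ℂ} (hw : ‖w‖ ≤ 1) (x : ℝ) :
    |Real.sin x ^ 2 - w.im ^ 2| ≤ 2 * ‖w - Complex.exp (x * Complex.I)‖ := by
  have hsum : |Real.sin x + w.im| ≤ 2 := by
    linarith [abs_add_le (Real.sin x) w.im, Real.abs_sin_le_one x, Complex.abs_im_le_norm w]
  have hdiff : |Real.sin x - w.im| ≤ ‖w - Complex.exp (x * Complex.I)‖ := by
    rw [abs_sub_comm]
    simpa [Complex.exp_ofReal_mul_I_im] using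
      Complex.abs_im_le_norm (w - Complex.exp (x * Complex.I))
  rw [sq_sub_sq, abs_mul]
  exact mul_le_mul hsum hdiff (abs_nonneg _) zero_le_two

/-- Truncated eigenvalue approximation: in the setting of the fixed-precision
repeated-squaring scheme (`ν ≥ 1`, `m ≥ 1`, `M = 2^m`, `r = 2^{ν+7}`,
`s = max(2ν+9, 11+ν+m)`), let `ℓ_j` be the truncation of
`4M²·(Im Ŵ_{r,j})²` to `ν` binary digits after the binary point
(`0 ≤ 4M²·(Im Ŵ_{r,j})² - ℓ_j ≤ 2^{-ν}`). Then
`|4M²·sin²(jπ/(2M)) - ℓ_j| ≤ 17·2^{-ν}·M²` for every `j = 1, …, M-1`. -/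
theorem truncated_eigenvalue_error
    (ν m : ℕ) (hν : 1 ≤ ν) (hm : 1 ≤ m) (s : ℕ)
    (hs : s = max (2*ν + 9) (11 + ν + m))
    (yh : ℕ → ℝ) (Wh : ℕ → ℕ → ℂ) (ℓ : ℕ → ℝ)
    (hy1 : ∀ j, 1 ≤ j → j ≤ 2^m - 1 →
      0 ≤ (j * π / (2 * 2^m)) / 2^(ν+7) - yh j)
    (hy2 : ∀ j, 1 ≤ j → j ≤ 2^m - 1 →
      (j * π / (2 * 2^m)) / 2^(ν+7) - yh j ≤ (2:ℝ)^(-(s:ℤ)))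
    (h0re : ∀ j, 1 ≤ j → j ≤ 2^m - 1 →
      |(Wh j 0 - (1 - (yh j : ℂ)^2 + (yh j : ℝ) * Complex.I)).re| ≤ (2:ℝ)^(-(s:ℤ)))
    (h0im : ∀ j, 1 ≤ j → j ≤ 2^m - 1 →
      |(Wh j 0 - (1 - (yh j : ℂ)^2 + (yh j : ℝ) * Complex.I)).im| ≤ (2:ℝ)^(-(s:ℤ)))
    (h0norm : ∀ j, 1 ≤ j → j ≤ 2^m - 1 →
      ‖Wh j 0‖ ≤ ‖1 - (yh j : ℂ)^2 + (yh j : ℝ) * Complex.I‖)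
    (hstepre : ∀ j, 1 ≤ j → j ≤ 2^m - 1 → ∀ i < ν + 7,
      |(Wh j (i+1) - (Wh j i)^2).re| ≤ (2:ℝ)^(-(s:ℤ)))
    (hstepim : ∀ j, 1 ≤ j → j ≤ 2^m - 1 → ∀ i < ν + 7,
      |(Wh j (i+1) - (Wh j i)^2).im| ≤ (2:ℝ)^(-(s:ℤ)))
    (hstepnorm : ∀ j, 1 ≤ j → j ≤ 2^m - 1 → ∀ i < ν + 7,
      ‖Wh j (i+1)‖ ≤ ‖Wh j i‖^2)
    (hℓ1 : ∀ j : ℕ, 1 ≤ j → j ≤ 2^m - 1 →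
      0 ≤ 4 * ((2:ℝ)^m)^2 * ((Wh j (ν+7)).im)^2 - ℓ j)
    (hℓ2 : ∀ j : ℕ, 1 ≤ j → j ≤ 2^m - 1 →
      4 * ((2:ℝ)^m)^2 * ((Wh j (ν+7)).im)^2 - ℓ j ≤ (2:ℝ)^(-(ν:ℤ))) :
    ∀ j : ℕ, 1 ≤ j → j ≤ 2^m - 1 →
      |4 * ((2:ℝ)^m)^2 * Real.sin (j * π / (2 * 2^m))^2 - ℓ j|
        ≤ 17 * (2:ℝ)^(-(ν:ℤ)) * ((2:ℝ)^m)^2 := by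
  intro j hj1 hj2
  set x : ℝ := j * π / (2 * 2 ^ m) with hx
  set ε : ℝ := (2 : ℝ) ^ (-(s : ℤ)) with hε
  set T : ℝ := (2 : ℝ) ^ (-(ν : ℤ)) with hT
  set y : ℝ := x / 2 ^ (ν + 7) with hy
  have hεpos : 0 < ε := by positivity
  have hTpos : 0 < T := by positivity
  have hM1 : (1 : ℝ) ≤ 2 ^ m := one_le_pow₀ one_le_two
  have hjM : (j : ℝ) ≤ 2 ^ m := by
    have : j ≤ 2 ^ m := hj2.trans (Nat.sub_le _ _)
    exact_mod_cast this
  have hx0 : 0 ≤ x := by positivity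
  have hx2 : x ≤ 2 := by
    rw [hx, div_le_iff₀ (by positivity)]
    nlinarith [Real.pi_le_four, Real.pi_pos]
  have hrT : (2 : ℝ) ^ (ν + 7) * T = 128 := by
    rw [hT, zpow_neg, zpow_natCast, pow_add]
    field_simp
    norm_num
  have hrε : (2 : ℝ) ^ (ν + 7) * ε ≤ T / 4 := by
    have hle : ε ≤ (2 : ℝ) ^ (-((2 * ν + 9 : ℕ) : ℤ)) := by
      apply zpow_le_zpow_right₀ one_le_two
      omega
    have heq : (2 : ℝ) ^ (ν + 7) * (2 : ℝ) ^ (-((2 * ν + 9 : ℕ) : ℤ)) = T / 4 := by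
      rw [hT, zpow_neg, zpow_neg, zpow_natCast, zpow_natCast, pow_add, pow_add, two_mul, pow_add]
      field_simp
      norm_num
    rw [← heq]
    gcongr
  have hr : (128 : ℝ) ≤ 2 ^ (ν + 7) := by
    rw [pow_add]
    nlinarith [one_le_pow₀ (n := ν) (one_le_two (α := ℝ))]
  have hry : (2 : ℝ) ^ (ν + 7) * y = x := by
    rw [hy]
    field_simp
  have hε1 : ε ≤ 1 := zpow_le_one_of_nonpos₀ one_le_two (by omega)
  have hy0 : 0 ≤ y := by positivity
  have hy1' : y ≤ 1 := by nlinarith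
  have hry2 : (2 : ℝ) ^ (ν + 7) * y ^ 2 ≤ T / 32 := by
    have : y = x * T / 128 := by
      rw [← hrT, ← hry]
      field_simp
    calc (2 : ℝ) ^ (ν + 7) * y ^ 2 = x * y := by rw [← hry]; ring
      _ = x ^ 2 * T / 128 := by rw [this]; ring
      _ ≤ T / 32 := by nlinarith [mul_nonneg hTpos.le (by nlinarith : 0 ≤ 4 - x ^ 2)]
  have hlo := hy1 j hj1 hj2
  have hhi := hy2 j hj1 hj2
  rw [← hx, ← hy] at hlo hhi
  have hyh : |yh j| ≤ 1 := abs_le.2 ⟨by linarith, by linarith⟩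
  have hyhsq : yh j ^ 2 ≤ y ^ 2 + ε := by
    rcases le_total 0 (yh j) with h | h <;> nlinarith
  have hdiff : |y - yh j| ≤ ε := abs_le.2 ⟨by linarith, hhi⟩
  have hnorm : ∀ i ≤ ν + 7, ‖Wh j i‖ ≤ 1 := by
    intro i
    induction i with
    | zero => exact fun _ => (h0norm j hj1 hj2).trans (norm_one_sub_sq_add_mul_I_le_one hyh)
    | succ i ih =>
      intro hi
      exact (hstepnorm j hj1 hj2 i (by omega)).trans
        (pow_le_one₀ (norm_nonneg _) (ih (by omega)))
  have hstart : ‖Wh j 0 - Complex.exp (y * Complex.I)‖ ≤ 2 * y ^ 2 + 4 * ε := by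
    have htri := norm_sub_le_norm_sub_add_norm_sub (Wh j 0)
      (1 - (yh j : ℂ) ^ 2 + (yh j : ℝ) * Complex.I) (Complex.exp (y * Complex.I))
    linarith [norm_le_two_mul_of_abs_re_le_of_abs_im_le (h0re j hj1 hj2) (h0im j hj1 hj2),
      norm_one_sub_sq_add_mul_I_sub_exp_le (x := y) (y := yh j) (abs_le.2 ⟨by linarith, hy1'⟩)]
  have herr := norm_repeated_squaring_sub_exp_le (z := y * Complex.I)
    (fun i => by
      rw [show (2 : ℂ) ^ i * (y * Complex.I) = ((2 ^ i * y : ℝ) : ℂ) * Complex.I by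
        push_cast; ring]
      exact Complex.norm_exp_ofReal_mul_I _)
    hstart hnorm
    (fun i hi => norm_le_two_mul_of_abs_re_le_of_abs_im_le
      (hstepre j hj1 hj2 i hi) (hstepim j hj1 hj2 i hi)) (ν + 7) le_rfl
  have hangle : (2 : ℂ) ^ (ν + 7) * (y * Complex.I) = x * Complex.I := by
    rw [← hry]
    push_cast
    ring
  rw [hangle] at herr
  have hsq : |Real.sin x ^ 2 - (Wh j (ν + 7)).im ^ 2| ≤ 4 * T := by
    linarith [abs_sin_sq_sub_im_sq_le (hnorm (ν + 7) le_rfl) x]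
  have hl1 := hℓ1 j hj1 hj2
  have hl2 := hℓ2 j hj1 hj2
  have hMsq : (1 : ℝ) ≤ (2 ^ m) ^ 2 := one_le_pow₀ hM1
  obtain ⟨h1, h2⟩ := abs_le.1 hsq
  have hTM := mul_le_mul_of_nonneg_left hMsq hTpos.le
  have h1' := mul_le_mul_of_nonneg_left h1 (zero_le_one.trans hMsq)
  have h2' := mul_le_mul_of_nonneg_left h2 (zero_le_one.trans hMsq)
  rw [abs_le]
  constructor <;> linarith
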